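/- For all squarefree r and all x ≥ 1, |b_r(x) − (6/π²)∏_{p|r}(p/(p+1))·x| ≤ k·e^{c√(log r)/log log r}·√x for r ≥ N+1, and ≤ k√x for r ≤ N, where k = 3.5·∏_{2≤p≤23}(1 + 1/√p), c = 4√(2.4/log 2), and N = 6469693229. -/

import Mathlib

/-- `b r x` counts squarefree `n ≤ x` coprime to `r`. -/
noncomputable def b (r : ℕ) (x : ℝ) : ℕ :=
  {n : ℕ | Squarefree n ∧ Nat.Coprime n r ∧ (n : ℝ) ≤ x}.ncard

noncomputable def kConst : ℝ :=
  3.5 * ∏ p ∈ (Finset.range 24).filter Nat.Prime, (1 + 1 / Real.sqrt p)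

noncomputable def cConst : ℝ := 4 * Real.sqrt (2.4 / Real.log 2)
noncomputable def gfun (r d : ℕ) : ℝ := if Nat.Coprime d r then ((ArithmeticFunction.moebius d : ℤ) : ℝ) else 0

lemma gfun_abs (r d : ℕ) : |gfun r d| ≤ 1 := by
  unfold gfun
  split_ifs
  · have := @ArithmeticFunction.abs_moebius_le_one d
    exact_mod_cast this
  · simp

open scoped LSeries.notation in
lemma gfun_hasSum (r : ℕ) (hr : r ≠ 0) :
    HasSum (fun d : ℕ => gfun r d / (d:ℝ)^2)
      (6 / Real.pi ^ 2 * ∏ p ∈ r.primeFactors, (1 - 1 / (p:ℝ)^2)⁻¹) := by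
  have : NeZero r := ⟨hr⟩
  set χ : DirichletCharacter ℂ r := 1 with hχ
  have h2 : (1:ℝ) < (2:ℂ).re := by norm_num
  have h1 := DirichletCharacter.LSeries.mul_mu_eq_one χ h2
  have h3 : LSeries ↗χ 2 = (∏ p ∈ r.primeFactors, (1 - (p : ℂ) ^ (-2:ℂ))) * riemannZeta 2 := by
    rw [← DirichletCharacter.LFunctionTrivChar_eq_mul_riemannZeta (by norm_num)]
    exact (DirichletCharacter.LFunction_eq_LSeries χ h2).symm
  have hs : LSeriesSummable (↗χ * ↗ArithmeticFunction.moebius) 2 :=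
    DirichletCharacter.LSeriesSummable_mul χ <| ArithmeticFunction.LSeriesSummable_moebius_iff.mpr h2
  have hs' := hs.LSeriesHasSum
  unfold LSeriesHasSum at hs'
  rw [← Complex.hasSum_ofReal]
  convert hs' using 1
  · ext d
    rcases eq_or_ne d 0 with rfl | hd
    · simp
    · rw [LSeries.term_of_ne_zero hd]
      simp only [gfun, Pi.mul_apply]
      by_cases hc : Nat.Coprime d r
      · have : IsUnit (d : ZMod r) := (ZMod.isUnit_iff_coprime d r).2 hc
        rw [if_pos hc]; simp [hχ, MulChar.one_apply this]
      · have : ¬ IsUnit (d : ZMod r) := fun h => hc ((ZMod.isUnit_iff_coprime d r).1 h)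
        simp [hc, hχ, MulChar.map_nonunit _ this]
  · have h4 : LSeries (↗χ * ↗ArithmeticFunction.moebius) 2 = (LSeries ↗χ 2)⁻¹ :=
      eq_inv_of_mul_eq_one_right h1
    rw [h4, h3, riemannZeta_two, mul_inv, ← Finset.prod_inv_distrib]
    push_cast
    rw [mul_comm]
    congr 1
    · apply Finset.prod_congr rfl
      intro p hp
      congr 2
      rw [Complex.cpow_neg]
      simp
    · simp

open Classical in
lemma mobius_id (r n N : ℕ) (hn : n ≠ 0) (hN : n ≤ N) :
    ∑ d ∈ Finset.range (N+1), (if d^2 ∣ n then gfun r d else 0) =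
      if (∀ p : ℕ, p.Prime → ¬ p ∣ r → ¬ p^2 ∣ n) then 1 else 0 := by
  set S := n.primeFactors.filter (fun p => ¬ p ∣ r ∧ p^2 ∣ n) with hS
  set P := ∏ p ∈ S, p with hP
  have hSp : ∀ p ∈ S, p.Prime := fun p hp => (Nat.mem_primeFactors.1 (Finset.mem_filter.1 hp).1).1
  have hP0 : P ≠ 0 := Finset.prod_ne_zero_iff.2 fun p hp => (hSp p hp).ne_zero
  have hPn : P^2 ∣ n := by
    rw [hP, ← Finset.prod_pow]
    apply Finset.prod_dvd_of_isRelPrime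
    · intro p hp q hq hpq
      have := ((Nat.coprime_primes (hSp p hp) (hSp q hq)).2 hpq)
      exact Nat.coprime_iff_isRelPrime.1 (Nat.Coprime.pow 2 2 this)
    · intro p hp
      exact (Finset.mem_filter.1 hp).2.2
  have hPr : Nat.Coprime P r := by
    rw [hP]
    apply Nat.Coprime.prod_left
    intro p hp
    exact (Nat.Prime.coprime_iff_not_dvd (hSp p hp)).2 (Finset.mem_filter.1 hp).2.1
  have key : ∑ d ∈ Finset.range (N+1), (if d^2 ∣ n then gfun r d else 0) =
      ∑ d ∈ P.divisors, ((ArithmeticFunction.moebius d : ℤ) : ℝ) := by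
    symm
    rw [← Finset.sum_subset (s₁ := P.divisors) (s₂ := Finset.range (N+1))]
    · apply Finset.sum_congr rfl
      intro d hd
      have hd := (Nat.mem_divisors.1 hd).1
      rw [if_pos ((pow_dvd_pow_of_dvd hd 2).trans hPn)]
      unfold gfun
      rw [if_pos (Nat.Coprime.coprime_dvd_left hd hPr)]
    · intro d hd
      have hd := (Nat.mem_divisors.1 hd).1
      have h1 : d^2 ∣ n := (pow_dvd_pow_of_dvd hd 2).trans hPn
      have h2 : d ∣ n := (Dvd.intro_left (d^1) (by ring)).trans h1
      have := Nat.le_of_dvd (Nat.pos_of_ne_zero hn) h2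
      simp; omega
    · intro d _ hd
      split_ifs with h
      · unfold gfun
        split_ifs with hc
        · by_cases hsq : Squarefree d
          · exfalso
            apply hd
            rw [Nat.mem_divisors]
            refine ⟨?_, hP0⟩
            rw [← Nat.prod_primeFactors_of_squarefree hsq]
            apply Finset.prod_dvd_prod_of_subset
            intro p hp
            obtain ⟨pp, pd, d0⟩ := Nat.mem_primeFactors.1 hp
            have h2 : p^2 ∣ n := (pow_dvd_pow_of_dvd pd 2).trans h
            refine Finset.mem_filter.2 ⟨Nat.mem_primeFactors.2 ⟨pp, ?_, hn⟩, ?_, h2⟩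
            · exact (Dvd.intro_left (p^1) (by ring)).trans h2
            · exact (Nat.Prime.coprime_iff_not_dvd pp).1 (Nat.Coprime.coprime_dvd_left pd hc)
          · simp [ArithmeticFunction.moebius_eq_zero_of_not_squarefree hsq]
        · rfl
      · rfl
  rw [key]
  have h := congrArg (fun f => f P) (ArithmeticFunction.coe_zeta_mul_coe_moebius (R := ℝ))
  simp only [ArithmeticFunction.coe_zeta_mul_apply] at h
  have h' : ∑ d ∈ P.divisors, ((ArithmeticFunction.moebius d : ℤ) : ℝ) = if P = 1 then 1 else 0 := by
    rw [← ArithmeticFunction.one_apply, ← h]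
    simp
  rw [h']
  congr 1
  rw [eq_iff_iff, hP, Finset.prod_eq_one_iff]
  constructor
  · intro h p pp pr pn
    have : p ∈ S := Finset.mem_filter.2 ⟨Nat.mem_primeFactors.2 ⟨pp, (Dvd.intro_left (p^1) (by ring)).trans pn, hn⟩, pr, pn⟩
    exact pp.one_lt.ne' (h p this)
  · intro h p hp
    exact absurd (Finset.mem_filter.1 hp).2.2 (h p (hSp p hp) (Finset.mem_filter.1 hp).2.1)

lemma fract_sum (t : ℝ) (ht : 0 ≤ t) (n : ℕ) :
    ∑ d ∈ Finset.range n, Int.fract (t^2 / (d:ℝ)^2) ≤ 3 * t := by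
  rcases Nat.eq_zero_or_pos n with rfl | hn
  · simp; exact ht
  obtain ⟨m, rfl⟩ : ∃ m, n = m + 1 := ⟨n-1, by omega⟩
  have main : ∀ m : ℕ, ∑ d ∈ Finset.range (m+1), Int.fract (t^2 / (d:ℝ)^2) ≤
      if (m:ℝ) ≤ t then (m:ℝ) else 3 * t - t^2 / m := by
    intro m
    induction m with
    | zero => simp [ht]
    | succ k ih =>
      rw [Finset.sum_range_succ]
      have f1 : Int.fract (t^2 / ((k+1:ℕ):ℝ)^2) ≤ 1 := (Int.fract_lt_one _).le
      have f2 : Int.fract (t^2 / ((k+1:ℕ):ℝ)^2) ≤ t^2 / ((k+1:ℕ):ℝ)^2 := by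
        have h0 : 0 ≤ t^2 / ((k+1:ℕ):ℝ)^2 := by positivity
        have := Int.floor_nonneg.2 h0
        have h3 := Int.self_sub_floor (t^2 / ((k+1:ℕ):ℝ)^2)
        have : (0:ℝ) ≤ (⌊t^2 / ((k+1:ℕ):ℝ)^2⌋ : ℤ) := by exact_mod_cast this
        linarith
      push_cast at *
      have kp : (0:ℝ) < (k:ℝ) + 1 := by positivity
      by_cases h1 : (k:ℝ) + 1 ≤ t
      · rw [if_pos h1]
        rw [if_pos (by linarith)] at ih
        linarith
      · rw [if_neg h1]
        push Not at h1
        by_cases h2 : (k:ℝ) ≤ t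
        · rw [if_pos h2] at ih
          have e1 : t^2/((k:ℝ)+1) ≤ t := by
            rw [div_le_iff₀ kp]; nlinarith
          have e2 : t^2/((k:ℝ)+1)^2 ≤ t := by
            rw [div_le_iff₀ (by positivity)]
            have : (k:ℝ) + 1 ≥ 1 := by linarith [Nat.cast_nonneg (α := ℝ) k]
            nlinarith [mul_nonneg ht (sub_nonneg.2 this)]
          linarith
        · rw [if_neg h2] at ih
          push Not at h2
          have k0 : (0:ℝ) < k := lt_of_le_of_lt ht h2
          have : t^2/((k:ℝ)+1)^2 ≤ t^2/k - t^2/((k:ℝ)+1) := by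
            rw [div_sub_div _ _ k0.ne' kp.ne', div_le_div_iff₀ (by positivity) (by positivity)]
            have : 0 ≤ t^2 := by positivity
            nlinarith [mul_nonneg this kp.le]
          linarith
  refine (main m).trans ?_
  split_ifs with h
  · linarith
  · have : 0 ≤ t^2/(m:ℝ) := by positivity
    linarith

open Classical in
lemma base (r : ℕ) (hr : r ≠ 0) (x : ℝ) (hx : 0 ≤ x) :
    |(((Finset.Icc 1 ⌊x⌋₊).filter
        (fun n => ∀ p : ℕ, p.Prime → ¬ p ∣ r → ¬ p^2 ∣ n)).card : ℝ) -
      (6 / Real.pi ^ 2 * ∏ p ∈ r.primeFactors, (1 - 1 / (p:ℝ)^2)⁻¹) * x| ≤ 3 * √x := by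
  set N := ⌊x⌋₊ with hN
  have h1 : (((Finset.Icc 1 N).filter
        (fun n => ∀ p : ℕ, p.Prime → ¬ p ∣ r → ¬ p^2 ∣ n)).card : ℝ) =
      ∑ d ∈ Finset.range (N+1), gfun r d * ((⌊x / (d:ℝ)^2⌋ : ℤ) : ℝ) := by
    rw [Finset.card_filter]
    push_cast
    rw [Finset.sum_congr rfl (fun n hn => (mobius_id r n N (by
      have := (Finset.mem_Icc.1 hn).1; omega) (Finset.mem_Icc.1 hn).2).symm), Finset.sum_comm]
    apply Finset.sum_congr rfl
    intro d hd
    rw [← Finset.sum_filter, Finset.sum_const, nsmul_eq_mul, mul_comm]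
    congr 1
    have e1 : (⌊x / (d:ℝ)^2⌋ : ℤ) = ((N / d^2 : ℕ) : ℤ) := by
      have : (⌊x / ((d^2 : ℕ):ℝ)⌋₊) = N / d^2 := by rw [Nat.floor_div_natCast]
      rw [← this]
      push_cast
      rw [Int.natCast_floor_eq_floor (by positivity)]
    rw [e1, ← Nat.card_multiples' N (d^2)]
    push_cast
    congr 2
    ext n
    simp only [Finset.mem_filter, Finset.mem_Icc, Finset.mem_range]
    constructor
    · rintro ⟨⟨a, c⟩, e⟩
      exact ⟨by omega, by omega, e⟩
    · rintro ⟨a, c, e⟩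
      exact ⟨⟨by omega, by omega⟩, e⟩
  have h2 : HasSum (fun d => gfun r d * ((⌊x / (d:ℝ)^2⌋ : ℤ) : ℝ))
      (∑ d ∈ Finset.range (N+1), gfun r d * ((⌊x / (d:ℝ)^2⌋ : ℤ) : ℝ)) := by
    apply hasSum_sum_of_ne_finset_zero
    intro d hd
    have hd : N + 1 ≤ d := by simpa using hd
    have : ⌊x / (d:ℝ)^2⌋ = 0 := by
      rw [Int.floor_eq_zero_iff]
      have hd1 : (1:ℝ) ≤ d := by exact_mod_cast (by omega : 1 ≤ d)
      have hd2 : x < d := (Nat.lt_floor_add_one x).trans_le (by exact_mod_cast hd)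
      refine ⟨by positivity, ?_⟩
      rw [div_lt_one (by positivity)]
      nlinarith
    simp [this]
  have h3 := (gfun_hasSum r hr).mul_right x
  have h4 := h2.sub h3
  rw [h1, ← h4.tsum_eq]
  have hsq : √x ^ 2 = x := Real.sq_sqrt hx
  have fs : Summable (fun d : ℕ => Int.fract (√x^2/(d:ℝ)^2)) :=
    summable_of_sum_range_le (fun d => Int.fract_nonneg _) (fract_sum √x (Real.sqrt_nonneg x))
  have ft := Real.tsum_le_of_sum_range_le (fun d => Int.fract_nonneg _) (fract_sum √x (Real.sqrt_nonneg x))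
  refine le_trans ?_ ft
  rw [← Real.norm_eq_abs]
  apply tsum_of_norm_bounded fs.hasSum
  intro d
  have : gfun r d * ((⌊x / (d:ℝ)^2⌋ : ℤ) : ℝ) - gfun r d / (d:ℝ)^2 * x =
    - gfun r d * Int.fract (x/(d:ℝ)^2) := by
    rw [← Int.self_sub_floor]; ring
  rw [this, hsq, Real.norm_eq_abs, abs_mul, abs_neg, abs_of_nonneg (Int.fract_nonneg (x / (d:ℝ)^2))]
  exact mul_le_of_le_one_left (Int.fract_nonneg _) (gfun_abs r d)

open Classical in
lemma stepN (r : ℕ) (p : ℕ) (hp : p.Prime) (hpr : p ∣ r) (s : Finset ℕ) (hs : ∀ q ∈ s, q.Prime)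
    (hps : p ∉ s) (x : ℝ) :
    ((Finset.Icc 1 ⌊x⌋₊).filter
        (fun n => (∀ q : ℕ, q.Prime → ¬ q ∣ r → ¬ q^2 ∣ n) ∧ ∀ q ∈ s, ¬ q ∣ n)).card =
    ((Finset.Icc 1 ⌊x⌋₊).filter
        (fun n => (∀ q : ℕ, q.Prime → ¬ q ∣ r → ¬ q^2 ∣ n) ∧ ∀ q ∈ insert p s, ¬ q ∣ n)).card +
    ((Finset.Icc 1 ⌊x/p⌋₊).filter
        (fun n => (∀ q : ℕ, q.Prime → ¬ q ∣ r → ¬ q^2 ∣ n) ∧ ∀ q ∈ s, ¬ q ∣ n)).card := by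
  rw [← Finset.card_filter_add_card_filter_not (s := ((Finset.Icc 1 ⌊x⌋₊).filter
        (fun n => (∀ q : ℕ, q.Prime → ¬ q ∣ r → ¬ q^2 ∣ n) ∧ ∀ q ∈ s, ¬ q ∣ n))) (fun n => ¬ p ∣ n)]
  congr 1
  · rw [Finset.filter_filter]
    congr 1
    apply Finset.filter_congr
    intro n _
    simp only [Finset.forall_mem_insert]
    tauto
  · symm
    have c1 : ∀ q : ℕ, q.Prime → ¬ q ∣ r → ∀ m, (q^2 ∣ p * m ↔ q^2 ∣ m) := by
      intro q hq hqr m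
      have : Nat.Coprime (q^2) p := Nat.Coprime.pow_left 2 ((Nat.coprime_primes hq hp).2 (by
        rintro rfl; exact hqr hpr))
      exact this.dvd_mul_left
    have c2 : ∀ q ∈ s, ∀ m, (q ∣ p * m ↔ q ∣ m) := by
      intro q hq m
      have : Nat.Coprime q p := ((Nat.coprime_primes (hs q hq) hp).2 (by
        rintro rfl; exact hps hq))
      exact this.dvd_mul_left
    have c3 : ⌊x/p⌋₊ = ⌊x⌋₊ / p := Nat.floor_div_natCast x p
    apply Finset.card_bij (fun m _ => p * m)
    · intro m hm
      simp only [Finset.mem_filter, Finset.mem_Icc, not_not] at hm ⊢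
      obtain ⟨⟨h1, h2⟩, h3, h4⟩ := hm
      rw [c3, Nat.le_div_iff_mul_le hp.pos] at h2
      refine ⟨⟨⟨?_, by rw [mul_comm]; exact h2⟩, ?_, ?_⟩, dvd_mul_right _ _⟩
      · exact Nat.mul_pos hp.pos h1
      · intro q hq hqr
        rw [c1 q hq hqr]; exact h3 q hq hqr
      · intro q hq
        rw [c2 q hq]; exact h4 q hq
    · intro a _ c _ h
      exact Nat.eq_of_mul_eq_mul_left hp.pos h
    · intro n hn
      simp only [Finset.mem_filter, Finset.mem_Icc, not_not] at hn
      obtain ⟨⟨⟨h1, h2⟩, h3, h4⟩, m, rfl⟩ := hn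
      refine ⟨m, ?_, rfl⟩
      simp only [Finset.mem_filter, Finset.mem_Icc]
      rw [c3, Nat.le_div_iff_mul_le hp.pos, mul_comm]
      refine ⟨⟨Nat.pos_of_ne_zero (by rintro rfl; simp at h1), h2⟩, ?_, ?_⟩
      · intro q hq hqr
        rw [← c1 q hq hqr]; exact h3 q hq hqr
      · intro q hq
        rw [← c2 q hq]; exact h4 q hq

open Classical in
lemma stepAll (r : ℕ) (hr : r ≠ 0) (s : Finset ℕ) (hs : s ⊆ r.primeFactors) :
    ∀ x : ℝ, 0 ≤ x →
    |(((Finset.Icc 1 ⌊x⌋₊).filter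
        (fun n => (∀ q : ℕ, q.Prime → ¬ q ∣ r → ¬ q^2 ∣ n) ∧ ∀ q ∈ s, ¬ q ∣ n)).card : ℝ) -
      (6 / Real.pi ^ 2 * ∏ p ∈ r.primeFactors, (1 - 1 / (p:ℝ)^2)⁻¹) *
        (∏ p ∈ s, (1 - 1/(p:ℝ))) * x| ≤ 3 * (∏ p ∈ s, (1 + 1/√(p:ℝ))) * √x := by
  induction s using Finset.induction_on with
  | empty =>
    intro x hx
    simpa using base r hr x hx
  | insert p s hps ih =>
    intro x hx
    have hs' : s ⊆ r.primeFactors := (Finset.subset_insert p s).trans hs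
    have hp := Nat.mem_primeFactors.1 (hs (Finset.mem_insert_self p s))
    have h := stepN r p hp.1 hp.2.1 s (fun q hq => (Nat.mem_primeFactors.1 (hs' hq)).1) hps x
    have i1 := ih hs' x hx
    have i2 := ih hs' (x/p) (by positivity)
    have h' := congrArg (Nat.cast (R := ℝ)) h
    rw [Nat.cast_add] at h'
    rw [h'] at i1
    rw [Finset.prod_insert hps, Finset.prod_insert hps]
    rw [Real.sqrt_div hx] at i2
    have e := abs_sub _ _ |>.trans (add_le_add i1 i2)
    refine le_trans (le_of_eq ?_) (e.trans (le_of_eq ?_))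
    · congr 1; ring
    · ring

lemma main_err (r : ℕ) (hr : Squarefree r) (x : ℝ) (hx : 1 ≤ x) :
    |(b r x : ℝ) -
        (6 / Real.pi ^ 2) * (∏ p ∈ r.primeFactors, (p : ℝ) / ((p : ℝ) + 1)) * x|
      ≤ 3 * (∏ p ∈ r.primeFactors, (1 + 1/√(p:ℝ))) * √x := by
  classical
  have h := stepAll r hr.ne_zero r.primeFactors subset_rfl x (by linarith)
  have e1 : b r x = ((Finset.Icc 1 ⌊x⌋₊).filter
        (fun n => (∀ q : ℕ, q.Prime → ¬ q ∣ r → ¬ q^2 ∣ n) ∧ ∀ q ∈ r.primeFactors, ¬ q ∣ n)).card := by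
    unfold b
    rw [← Set.ncard_coe_finset]
    congr 1
    ext n
    simp only [Set.mem_ofPred_eq, Finset.coe_filter, Finset.mem_Icc]
    rw [Nat.le_floor_iff (by linarith : (0:ℝ) ≤ x)]
    constructor
    · rintro ⟨h1, h2, h3⟩
      refine ⟨⟨Nat.pos_of_ne_zero h1.ne_zero, h3⟩, ?_, ?_⟩
      · intro q hq _ hd
        exact (Nat.squarefree_iff_prime_squarefree.1 h1) q hq (by rwa [← sq])
      · intro q hq hd
        have hq := Nat.mem_primeFactors.1 hq
        exact Nat.not_coprime_of_dvd_of_dvd hq.1.one_lt hd hq.2.1 h2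
    · rintro ⟨⟨h1, h3⟩, h4, h5⟩
      refine ⟨?_, ?_, h3⟩
      · rw [Nat.squarefree_iff_prime_squarefree]
        intro q hq hd
        by_cases hqr : q ∣ r
        · exact h5 q (Nat.mem_primeFactors.2 ⟨hq, hqr, hr.ne_zero⟩) ((dvd_mul_right q q).trans hd)
        · exact h4 q hq hqr (by rwa [sq])
      · apply Nat.coprime_of_dvd
        intro q hq hqn hqr
        exact h5 q (Nat.mem_primeFactors.2 ⟨hq, hqr, hr.ne_zero⟩) hqn
  rw [e1]
  convert h using 4
  rw [mul_assoc, ← Finset.prod_mul_distrib]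
  congr 1
  apply Finset.prod_congr rfl
  intro p hp
  have hp2 : (2:ℝ) ≤ p := by exact_mod_cast (Nat.mem_primeFactors.1 hp).1.two_le
  have : (p:ℝ)^2 - 1 ≠ 0 := by nlinarith
  have : (p:ℝ) - 1 ≠ 0 := by linarith
  have : (p:ℝ) + 1 ≠ 0 := by linarith
  have : (1 - 1/(p:ℝ)^2) = ((p:ℝ)-1)*((p:ℝ)+1)/(p:ℝ)^2 := by field_simp; ring
  rw [this]
  field_simp

lemma primes24 : (Finset.range 24).filter Nat.Prime = {2,3,5,7,11,13,17,19,23} := by decide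

lemma primes30 : (Finset.range 30).filter Nat.Prime = {2,3,5,7,11,13,17,19,23,29} := by decide

lemma card_sdiff_aux (S P : Finset ℕ) (h : S.card ≤ P.card) : (S \ P).card ≤ (P \ S).card := by
  have h1 := Finset.card_sdiff_add_card_inter S P
  have h2 := Finset.card_sdiff_add_card_inter P S
  rw [Finset.inter_comm] at h2
  omega

lemma swap_prod (S : Finset ℕ) (hS : ∀ p ∈ S, p.Prime) (hc : S.card ≤ 9) :
    ∏ p ∈ S, (1 + 1/√(p:ℝ)) ≤ ∏ p ∈ (Finset.range 24).filter Nat.Prime, (1 + 1/√(p:ℝ)) := by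
  set P := (Finset.range 24).filter Nat.Prime with hP
  have hPc : P.card = 9 := by rw [hP, primes24]; rfl
  rw [← Finset.prod_inter_mul_prod_sdiff S P (fun p : ℕ => 1 + 1/√(p:ℝ)),
    ← Finset.prod_inter_mul_prod_sdiff P S (fun p : ℕ => 1 + 1/√(p:ℝ)), Finset.inter_comm P S]
  apply mul_le_mul_of_nonneg_left _ (Finset.prod_nonneg fun p _ => by positivity)
  have h23 : (1:ℝ) ≤ 1 + 1/√(23:ℝ) := by
    have : 0 ≤ 1/√(23:ℝ) := by positivity
    linarith
  calc ∏ p ∈ S \ P, (1 + 1/√(p:ℝ)) ≤ (1 + 1/√(23:ℝ))^(S \ P).card := by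
        rw [← Finset.prod_const]
        apply Finset.prod_le_prod
        · intros; positivity
        · intro p hp
          have hp := Finset.mem_sdiff.1 hp
          have h1 : (23:ℝ) ≤ p := by
            by_contra hlt
            push Not at hlt
            have hlt : p < 23 := by exact_mod_cast hlt
            exact hp.2 (Finset.mem_filter.2 ⟨Finset.mem_range.2 (by omega), hS p hp.1⟩)
          gcongr
    _ ≤ (1 + 1/√(23:ℝ))^(P \ S).card := pow_le_pow_right₀ h23 (card_sdiff_aux S P (by omega))
    _ ≤ ∏ p ∈ P \ S, (1 + 1/√(p:ℝ)) := by
        rw [← Finset.prod_const]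
        apply Finset.prod_le_prod
        · intros; positivity
        · intro p hp
          have hp := (Finset.mem_filter.1 (Finset.mem_sdiff.1 hp).1)
          have h0 : 0 < (p:ℝ) := by exact_mod_cast hp.2.pos
          have h1 : (p:ℝ) ≤ 23 := by
            have := Finset.mem_range.1 hp.1
            exact_mod_cast (by omega : p ≤ 23)
          gcongr

lemma omega_le (r : ℕ) (hr : Squarefree r) (h : r ≤ 6469693229) : r.primeFactors.card ≤ 9 := by
  by_contra hc
  push Not at hc
  set S := r.primeFactors with hS
  set P := (Finset.range 30).filter Nat.Prime with hP
  have hPc : P.card = 10 := by rw [hP, primes30]; rfl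
  have hPp : ∏ p ∈ P, p = 6469693230 := by rw [hP, primes30]; rfl
  have hr' : ∏ p ∈ S, p = r := Nat.prod_primeFactors_of_squarefree hr
  have : ∏ p ∈ P, p ≤ ∏ p ∈ S, p := by
    rw [← Finset.prod_inter_mul_prod_sdiff S P (fun p : ℕ => p),
      ← Finset.prod_inter_mul_prod_sdiff P S (fun p : ℕ => p), Finset.inter_comm P S]
    apply Nat.mul_le_mul_left
    calc ∏ p ∈ P \ S, p ≤ 29 ^ (P \ S).card := by
          apply Finset.prod_le_pow_card
          intro p hp
          have hp := (Finset.mem_filter.1 (Finset.mem_sdiff.1 hp).1)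
          have := Finset.mem_range.1 hp.1
          omega
      _ ≤ 29 ^ (S \ P).card := Nat.pow_le_pow_right (by norm_num) (card_sdiff_aux P S (by omega))
      _ ≤ ∏ p ∈ S \ P, p := by
          apply Finset.pow_card_le_prod
          intro p hp
          have hp := Finset.mem_sdiff.1 hp
          by_contra hlt
          exact hp.2 (Finset.mem_filter.2 ⟨Finset.mem_range.2 (by omega), (Nat.mem_primeFactors.1 hp.1).1⟩)
  omega

noncomputable def ff (n : ℕ) : ℝ := 1 / (√(n:ℝ) * Real.log n)

lemma log_ge_33 (t : ℝ) (ht : 28 ≤ t) : 3.3 ≤ Real.log t := by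
  rw [Real.le_log_iff_exp_le (by linarith)]
  have h1 : Real.exp 3.3 = (Real.exp 1)^3 * Real.exp 0.3 := by
    rw [← Real.exp_nat_mul, ← Real.exp_add]; norm_num
  have h2 : Real.exp 0.3 ≤ 1.36 := by
    have := Real.exp_bound' (x := 0.3) (by norm_num) (by norm_num) (n := 3) (by norm_num)
    refine this.trans ?_
    norm_num [Finset.sum_range_succ, Nat.factorial]
  have h3 : (Real.exp 1)^3 ≤ 2.7183^3 := by
    have := Real.exp_one_lt_d9
    gcongr
    linarith
  rw [h1]
  have := mul_le_mul h3 h2 (Real.exp_pos _).le (by norm_num)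
  refine this.trans ?_
  refine le_trans ?_ ht
  norm_num

lemma ff_step (n : ℕ) (hn : 28 ≤ n) : ff n ≤ ff (n+1) * (1 + 9/(11*(n:ℝ))) := by
  have hn' : (28:ℝ) ≤ n := by exact_mod_cast hn
  have hl := log_ge_33 n hn'
  have n0 : (0:ℝ) < n := by linarith
  have hs0 : 0 < √(n:ℝ) := Real.sqrt_pos.2 n0
  have hs : √((n:ℝ)+1) ≤ √(n:ℝ) * (1 + 1/(2*(n:ℝ))) := by
    rw [Real.sqrt_le_left (by positivity), mul_pow, Real.sq_sqrt n0.le]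
    have : (n:ℝ) * (1 + 1/(2*(n:ℝ)))^2 = n + 1 + 1/(4*n) := by field_simp; ring
    rw [this]
    have : 0 < 1/(4*(n:ℝ)) := by positivity
    linarith
  have hlog : Real.log ((n:ℝ)+1) ≤ Real.log n * (1 + 1/(3.3*(n:ℝ))) := by
    have e : (n:ℝ) + 1 = n * (1 + 1/n) := by field_simp
    rw [e, Real.log_mul n0.ne' (by positivity)]
    have := Real.log_le_sub_one_of_pos (show (0:ℝ) < 1 + 1/n by positivity)
    have h2 : 1/(n:ℝ) ≤ Real.log n * (1/(3.3*(n:ℝ))) := by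
      rw [mul_one_div, div_le_div_iff₀ n0 (by positivity)]
      nlinarith
    linarith
  have hl1 : 0 < Real.log ((n:ℝ)+1) := Real.log_pos (by linarith)
  have hs1 : 0 < √((n:ℝ)+1) := Real.sqrt_pos.2 (by linarith)
  unfold ff
  push_cast
  rw [div_mul_eq_mul_div, one_mul, div_le_div_iff₀ (by positivity) (by positivity), one_mul]
  calc √((n:ℝ)+1) * Real.log ((n:ℝ)+1) ≤ (√(n:ℝ) * (1 + 1/(2*(n:ℝ)))) * (Real.log n * (1 + 1/(3.3*(n:ℝ)))) :=
        mul_le_mul hs hlog hl1.le (by positivity)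
    _ = ((1 + 1/(2*(n:ℝ))) * (1 + 1/(3.3*(n:ℝ)))) * (√(n:ℝ) * Real.log n) := by ring
    _ ≤ _ := by
        apply mul_le_mul_of_nonneg_right _ (by positivity)
        have hu : 1/(n:ℝ) ≤ 1/28 := one_div_le_one_div_of_le (by norm_num) hn'
        have hu0 : 0 < 1/(n:ℝ) := by positivity
        have e1 : 1/(2*(n:ℝ)) = (1/2) * (1/n) := by field_simp
        have e2 : 1/(3.3*(n:ℝ)) = (10/33) * (1/n) := by field_simp; norm_num
        have e3 : 9/(11*(n:ℝ)) = (9/11) * (1/n) := by field_simp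
        rw [e1, e2, e3]
        nlinarith

lemma ff_anti (n : ℕ) (hn : 28 ≤ n) : ff (n+1) ≤ ff n := by
  have hn' : (28:ℝ) ≤ n := by exact_mod_cast hn
  have hl := log_ge_33 n hn'
  have hs0 : 0 < √(n:ℝ) := Real.sqrt_pos.2 (by linarith)
  unfold ff
  push_cast
  apply one_div_le_one_div_of_le (by positivity)
  apply mul_le_mul (Real.sqrt_le_sqrt (by linarith)) (Real.log_le_log (by linarith) (by linarith)) (by linarith) (Real.sqrt_nonneg _)

lemma theta_sum (n : ℕ) (hn : 28 ≤ n) :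
    ∑ p ∈ (Finset.Ioc 28 n).filter Nat.Prime, 1/√(p:ℝ) ≤
      Chebyshev.theta n * ff n + Real.log 4 * 4.5 * (n * ff n - 28 * ff 28) := by
  induction n, hn using Nat.le_induction with
  | base =>
    have : 0 ≤ Chebyshev.theta ((28:ℕ):ℝ) * ff 28 := by
      apply mul_nonneg (Chebyshev.theta_nonneg _)
      unfold ff
      have := log_ge_33 28 le_rfl
      push_cast
      positivity
    simp at this ⊢
    exact this
  | succ n hn ih =>
    have hn' : (28:ℝ) ≤ n := by exact_mod_cast hn
    have hl0 : 0 < Real.log ((n:ℝ)+1) := Real.log_pos (by linarith)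
    have f1 := ff_step n hn
    have f2 := ff_anti n hn
    have th : Chebyshev.theta n ≤ Real.log 4 * n := Chebyshev.theta_le_log4_mul_x (by linarith)
    have e : ∑ p ∈ (Finset.Ioc 28 (n+1)).filter Nat.Prime, 1/√(p:ℝ) =
        ∑ p ∈ (Finset.Ioc 28 n).filter Nat.Prime, 1/√(p:ℝ) +
        (Chebyshev.theta ((n+1:ℕ):ℝ) - Chebyshev.theta n) * ff (n+1) := by
      rw [Chebyshev.theta_eq_sum_Icc, Chebyshev.theta_eq_sum_Icc, Nat.floor_natCast, Nat.floor_natCast]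
      rw [Finset.sum_filter, Finset.sum_filter, Finset.sum_filter, Finset.sum_filter]
      rw [Finset.sum_Ioc_succ_top (by omega), Finset.sum_Icc_succ_top (by omega)]
      rw [add_sub_cancel_left]
      congr 1
      split_ifs
      · unfold ff
        push_cast
        field_simp
      · simp
    have hmul : (Chebyshev.theta n) * (ff n - ff (n+1)) ≤ Real.log 4 * n * (ff n - ff (n+1)) :=
      mul_le_mul_of_nonneg_right th (by linarith)
    have h4 : 0 < Real.log 4 := Real.log_pos (by norm_num)
    have n0 : (0:ℝ) < n := by linarith
    have k1 : (n:ℝ) * (ff n - ff (n+1)) ≤ 9/11 * ff (n+1) := by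
      have := mul_le_mul_of_nonneg_left f1 n0.le
      have e2 : (n:ℝ) * (ff (n+1) * (1 + 9/(11*(n:ℝ)))) = n * ff (n+1) + 9/11 * ff (n+1) := by
        field_simp
      linarith
    have k2 : (n:ℝ) * (ff n - ff (n+1)) ≤ 4.5 * (((n:ℝ)+1) * ff (n+1) - n * ff n) := by
      norm_num
      linarith
    have k3 := mul_le_mul_of_nonneg_left k2 h4.le
    rw [e]
    push_cast at *
    nlinarith

lemma sum_log_le (r : ℕ) (hr : r ≠ 0) (Q : Finset ℕ) (hQ : Q ⊆ r.primeFactors) :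
    ∑ p ∈ Q, Real.log p ≤ Real.log r := by
  rw [← Real.log_prod (fun p hp => by
    have := (Nat.mem_primeFactors.1 (hQ hp)).1.ne_zero
    exact_mod_cast this)]
  have hpos : 0 < ∏ p ∈ Q, p := Finset.prod_pos fun p hp => (Nat.mem_primeFactors.1 (hQ hp)).1.pos
  have hd : ∏ p ∈ Q, p ∣ r :=
    (Finset.prod_dvd_prod_of_subset _ _ _ hQ).trans (Nat.prod_primeFactors_dvd r)
  have hle := Nat.le_of_dvd (Nat.pos_of_ne_zero hr) hd
  apply Real.log_le_log
  · have : (0:ℝ) < ((∏ p ∈ Q, p : ℕ) : ℝ) := Nat.cast_pos.2 hpos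
    rwa [Nat.cast_prod] at this
  · have : ((∏ p ∈ Q, p : ℕ) : ℝ) ≤ (r:ℝ) := Nat.cast_le.2 hle
    rwa [Nat.cast_prod] at this

lemma tail_le (r : ℕ) (hr : r ≠ 0) (Q : Finset ℕ) (hQ : Q ⊆ r.primeFactors) (z : ℝ) (hz : 28 ≤ z)
    (h : ∀ p ∈ Q, z ≤ (p:ℝ)) :
    ∑ p ∈ Q, 1/√(p:ℝ) ≤ Real.log r / (√z * Real.log z) := by
  have hl := log_ge_33 z hz
  have hs0 : 0 < √z := Real.sqrt_pos.2 (by linarith)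
  have : ∑ p ∈ Q, 1/√(p:ℝ) ≤ ∑ p ∈ Q, Real.log p / (√z * Real.log z) := by
    apply Finset.sum_le_sum
    intro p hp
    have hzp := h p hp
    have h1 : √z ≤ √(p:ℝ) := Real.sqrt_le_sqrt hzp
    have h2 : Real.log z ≤ Real.log p := Real.log_le_log (by linarith) hzp
    rw [div_le_div_iff₀ (by linarith) (by positivity), one_mul, mul_comm]
    exact mul_le_mul h2 h1 hs0.le (by linarith)
  refine this.trans ?_
  rw [← Finset.sum_div]
  gcongr
  exact sum_log_le r hr Q hQ

lemma log4 : Real.log 4 = 2 * Real.log 2 := by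
  rw [show (4:ℝ) = 2^2 by norm_num, Real.log_pow]; norm_num

lemma log256 : Real.log 256 = 8 * Real.log 2 := by
  rw [show (256:ℝ) = 2^8 by norm_num, Real.log_pow]; norm_num

lemma ff28 : 1.5 ≤ 28 * ff 28 := by
  unfold ff
  have h1 : (5.29:ℝ) ≤ √28 := Real.le_sqrt_of_sq_le (by norm_num)
  have h2 : Real.log 28 ≤ 3.5 := by
    have : Real.log 28 ≤ Real.log 32 := Real.log_le_log (by norm_num) (by norm_num)
    have h3 : Real.log 32 = 5 * Real.log 2 := by
      rw [show (32:ℝ) = 2^5 by norm_num, Real.log_pow]; norm_num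
    have := Real.log_two_lt_d9
    linarith
  have h0 := log_ge_33 28 le_rfl
  have hsq : √(28:ℝ) * √28 = 28 := Real.mul_self_sqrt (by norm_num)
  push_cast
  rw [mul_one_div, le_div_iff₀ (by positivity)]
  nlinarith [mul_le_mul_of_nonneg_left h2 (Real.sqrt_nonneg (28:ℝ))]

lemma numeric (s l : ℝ) (hs0 : 0 ≤ s) (hl : 5.545 ≤ l) (hs : l < 6.4 → s ≤ 100) :
    5.8124 * s / (l - 1.3863) - 9 ≤ 7.44 * s / l := by
  have hl0 : 0 < l := by linarith
  have hl1 : 0 < l - 1.3863 := by linarith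
  rw [sub_le_iff_le_add, div_le_iff₀ hl1, div_add' _ _ _ hl0.ne', div_mul_eq_mul_div, le_div_iff₀ hl0]
  by_cases h : l < 6.4
  · have := hs h
    nlinarith [mul_nonneg hs0 (sub_nonneg.2 hl), mul_nonneg (sub_nonneg.2 hl) (sub_nonneg.2 hl)]
  · push Not at h
    nlinarith [mul_nonneg hs0 (sub_nonneg.2 h), mul_pos hl0 hl1]

lemma tail_sum (r : ℕ) (hr : 6469693230 ≤ r) :
    ∑ p ∈ r.primeFactors.filter (fun p => 24 ≤ p), 1/√(p:ℝ) ≤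
      7.44 * √(Real.log r) / Real.log (Real.log r) := by
  have hr0 : r ≠ 0 := by omega
  set Q := r.primeFactors.filter (fun p => 24 ≤ p) with hQd
  have hQ : Q ⊆ r.primeFactors := Finset.filter_subset _ _
  set L := Real.log r with hL
  have l2 := Real.log_two_lt_d9
  have l2' := Real.log_two_gt_d9
  have hL3 : 3.3 ≤ L := log_ge_33 r (by exact_mod_cast (by omega : 28 ≤ r))
  have hlL : 0 < Real.log L := Real.log_pos (by linarith)
  have hQ29 : ∀ p ∈ Q, 29 ≤ p := by
    intro p hp
    obtain ⟨hp1, hp2⟩ := Finset.mem_filter.1 hp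
    have pp := (Nat.mem_primeFactors.1 hp1).1
    by_contra hlt
    push Not at hlt
    interval_cases p <;> revert pp <;> norm_num
  have hsL : √L * √L = L := Real.mul_self_sqrt (by linarith)
  have hs0 : 0 < √L := Real.sqrt_pos.2 (by linarith)
  rcases le_or_gt L 256 with hc | hc
  · have h1 := tail_le r hr0 Q hQ 29 (by norm_num) (fun p hp => by exact_mod_cast hQ29 p hp)
    refine h1.trans ?_
    have h29 := log_ge_33 29 (by norm_num)
    have hs29 : (5.38:ℝ) ≤ √29 := Real.le_sqrt_of_sq_le (by norm_num)
    have hp : 17 ≤ √29 * Real.log 29 := by nlinarith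
    have hs16 : √L ≤ 16 := Real.sqrt_le_iff.2 ⟨by norm_num, by norm_num; exact hc⟩
    have hll : Real.log L ≤ 5.6 := by
      have := Real.log_le_log (by linarith) hc
      rw [log256] at this
      linarith
    rw [div_le_div_iff₀ (by linarith) hlL]
    have h3 : √L * Real.log L ≤ 16 * 5.6 := mul_le_mul hs16 hll hlL.le (by norm_num)
    calc Real.log r * Real.log L = √L * (√L * Real.log L) := by rw [← mul_assoc, hsL]
      _ ≤ √L * (7.44 * 17) := by
          apply mul_le_mul_of_nonneg_left _ hs0.le
          linarith
      _ = 7.44 * √L * 17 := by ring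
      _ ≤ _ := by gcongr
  · set z := L / 4 with hz
    set n := ⌊z⌋₊ with hn
    have hz64 : 64 < z := by rw [hz]; linarith
    have hn64 : 64 ≤ n := Nat.le_floor (by push_cast; exact hz64.le)
    have hnz : (n:ℝ) ≤ z := Nat.floor_le (by linarith)
    have hsplit : ∑ p ∈ Q, 1/√(p:ℝ) = ∑ p ∈ Q.filter (fun p => p ≤ n), 1/√(p:ℝ) +
        ∑ p ∈ Q.filter (fun p => ¬ p ≤ n), 1/√(p:ℝ) := (Finset.sum_filter_add_sum_filter_not _ _ _).symm
    have hA : ∑ p ∈ Q.filter (fun p => p ≤ n), 1/√(p:ℝ) ≤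
        ∑ p ∈ (Finset.Ioc 28 n).filter Nat.Prime, 1/√(p:ℝ) := by
      apply Finset.sum_le_sum_of_subset_of_nonneg
      · intro p hp
        obtain ⟨h1, h2⟩ := Finset.mem_filter.1 hp
        have := hQ29 p h1
        exact Finset.mem_filter.2 ⟨Finset.mem_Ioc.2 ⟨by omega, h2⟩, (Nat.mem_primeFactors.1 (hQ h1)).1⟩
      · intros; positivity
    have hB := tail_le r hr0 (Q.filter (fun p => ¬ p ≤ n)) ((Finset.filter_subset _ _).trans hQ) z
      (by linarith) (fun p hp => by
        have h2 := (Finset.mem_filter.1 hp).2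
        push Not at h2
        have := Nat.lt_floor_add_one z
        have h3 : ((n + 1 : ℕ) : ℝ) ≤ p := by exact_mod_cast h2
        push_cast at h3
        linarith)
    have hC := theta_sum n (by omega)
    have hn' : (64:ℝ) ≤ n := by exact_mod_cast hn64
    have hln := log_ge_33 n (by linarith)
    have hlz := log_ge_33 z (by linarith)
    have ffn : 0 ≤ ff n := by unfold ff; positivity
    have h4 : 0 < Real.log 4 := Real.log_pos (by norm_num)
    have hth : Chebyshev.theta n * ff n ≤ Real.log 4 * n * ff n :=
      mul_le_mul_of_nonneg_right (Chebyshev.theta_le_log4_mul_x (by linarith)) ffn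
    have hsn : 0 < √(n:ℝ) := Real.sqrt_pos.2 (by linarith)
    have hsz : 0 < √z := Real.sqrt_pos.2 (by linarith)
    have hF : n * ff n ≤ √z / Real.log z := by
      have e : n * ff n = √(n:ℝ) / Real.log n := by
        unfold ff
        have : (n:ℝ) = √(n:ℝ) * √(n:ℝ) := (Real.mul_self_sqrt (by linarith)).symm
        rw [mul_one_div, div_eq_div_iff (by positivity) (by positivity)]
        nth_rw 1 [this]
        ring
      rw [e]
      have he2 : Real.exp 2 ≤ 28 := by
        have : Real.exp 2 ≤ Real.exp 3.3 := Real.exp_le_exp.2 (by norm_num)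
        exact this.trans ((Real.le_log_iff_exp_le (by norm_num)).1 (log_ge_33 28 le_rfl))
      have := Real.log_div_sqrt_antitoneOn (a := (n:ℝ)) (b := z) (by
        show Real.exp 2 ≤ (n:ℝ); linarith) (by show Real.exp 2 ≤ z; linarith) hnz
      have := inv_anti₀ (by positivity) this
      simpa [inv_div] using this
    have hsz2 : √z = √L / 2 := by
      rw [hz, Real.sqrt_div (by linarith), show (4:ℝ) = 2^2 by norm_num, Real.sqrt_sq (by norm_num)]
    have hlz2 : Real.log z = Real.log L - Real.log 4 := by
      rw [hz, Real.log_div (by linarith) (by norm_num)]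
    have hB2 : L / (√z * Real.log z) = 2 * √L / Real.log z := by
      rw [hsz2, div_eq_div_iff (by positivity) (by positivity)]
      nth_rw 1 [← hsL]
      ring
    have hl256 : 5.545 ≤ Real.log L := by
      have := Real.log_le_log (by norm_num) hc.le
      rw [log256] at this
      linarith
    have hnum := numeric (√L) (Real.log L) hs0.le hl256 (fun h => by
      rw [Real.sqrt_le_iff]
      refine ⟨by norm_num, ?_⟩
      have h1 : L ≤ Real.exp 6.4 := (Real.log_le_iff_le_exp (by linarith)).1 h.le
      have h2 : Real.exp 6.4 ≤ Real.exp 9 := Real.exp_le_exp.2 (by norm_num)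
      have h3 : Real.exp 9 = (Real.exp 1)^9 := by rw [← Real.exp_nat_mul]; norm_num
      have h5 : (Real.exp 1)^9 ≤ 2.72^9 := by
        have := Real.exp_one_lt_d9
        gcongr; linarith
      have h6 : (2.72:ℝ)^9 ≤ 100^2 := by norm_num
      linarith)
    rw [hB2] at hB
    have hF0 : 0 ≤ √z / Real.log z := by positivity
    have l4 : Real.log 4 ≤ 1.3863 := by rw [log4]; linarith
    have l4' : 1.386 ≤ Real.log 4 := by rw [log4]; linarith
    have t1 : ∑ p ∈ Q, 1/√(p:ℝ) ≤ 5.5 * Real.log 4 * (√z / Real.log z) - Real.log 4 * 4.5 * (28 * ff 28)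
        + 2 * √L / Real.log z := by
      have := mul_le_mul_of_nonneg_left hF (show 0 ≤ 5.5 * Real.log 4 by positivity)
      linarith
    have t2 : 9 ≤ Real.log 4 * 4.5 * (28 * ff 28) := by
      have := ff28
      nlinarith
    have t3 : 5.5 * Real.log 4 * (√z / Real.log z) ≤ 5.5 * 1.3863 * (√z / Real.log z) := by
      gcongr
    have t4 : 5.5 * 1.3863 * (√z / Real.log z) + 2 * √L / Real.log z ≤ 5.8124 * √L / Real.log z := by
      rw [hsz2]
      have : 0 ≤ √L / Real.log z := by positivity
      have e1 : √L / 2 / Real.log z = (√L / Real.log z) / 2 := by ring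
      rw [e1, mul_div_assoc, mul_div_assoc]
      linarith
    have t5 : 5.8124 * √L / Real.log z ≤ 5.8124 * √L / (Real.log L - 1.3863) := by
      apply div_le_div_of_nonneg_left (by positivity) (by linarith) (by linarith)
    linarith

lemma c_ge : 7.44 ≤ cConst := by
  unfold cConst
  have l2 := Real.log_two_lt_d9
  have l2' := Real.log_two_gt_d9
  have : (1.86:ℝ) ≤ √(2.4 / Real.log 2) := by
    apply Real.le_sqrt_of_sq_le
    rw [le_div_iff₀ (by linarith)]
    linarith
  linarith

lemma big_prod (r : ℕ) (hr : 6469693230 ≤ r) :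
    ∏ p ∈ r.primeFactors, (1 + 1/√(p:ℝ)) ≤
      (∏ p ∈ (Finset.range 24).filter Nat.Prime, (1 + 1/√(p:ℝ))) *
        Real.exp (cConst * √(Real.log r) / Real.log (Real.log r)) := by
  have one_le : ∀ p : ℕ, 1 ≤ 1 + 1/√(p:ℝ) := fun p => by
    have : 0 ≤ 1/√(p:ℝ) := by positivity
    linarith
  rw [← Finset.prod_filter_mul_prod_filter_not r.primeFactors (fun p => 24 ≤ p), mul_comm]
  apply mul_le_mul
  · apply Finset.prod_le_prod_of_subset_of_one_le
    · intro p hp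
      obtain ⟨h1, h2⟩ := Finset.mem_filter.1 hp
      exact Finset.mem_filter.2 ⟨Finset.mem_range.2 (by omega), (Nat.mem_primeFactors.1 h1).1⟩
    · intros; positivity
    · intro p _ _; exact one_le p
  · calc _ ≤ ∏ p ∈ r.primeFactors.filter (fun p => 24 ≤ p), Real.exp (1/√(p:ℝ)) := by
          apply Finset.prod_le_prod
          · intros; positivity
          · intro p _
            rw [add_comm]; exact Real.add_one_le_exp _
      _ = Real.exp (∑ p ∈ r.primeFactors.filter (fun p => 24 ≤ p), 1/√(p:ℝ)) := (Real.exp_sum _ _).symm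
      _ ≤ _ := by
          apply Real.exp_le_exp.2
          refine (tail_sum r hr).trans ?_
          have hL3 : 3.3 ≤ Real.log r := log_ge_33 r (by exact_mod_cast (by omega : 28 ≤ r))
          have hlL : 0 < Real.log (Real.log r) := Real.log_pos (by linarith)
          have := c_ge
          gcongr
  · exact Finset.prod_nonneg fun p _ => by positivity
  · exact Finset.prod_nonneg fun p _ => by positivity

theorem stmt_12 (r : ℕ) (hr : Squarefree r) (x : ℝ) (hx : 1 ≤ x) :
    (r ≤ 6469693229 →
      |(b r x : ℝ) -
        (6 / Real.pi ^ 2) * (∏ p ∈ r.primeFactors, (p : ℝ) / ((p : ℝ) + 1)) * x|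
      ≤ kConst * Real.sqrt x) ∧
    (6469693229 + 1 ≤ r →
      |(b r x : ℝ) -
        (6 / Real.pi ^ 2) * (∏ p ∈ r.primeFactors, (p : ℝ) / ((p : ℝ) + 1)) * x|
      ≤ kConst * Real.exp (cConst * Real.sqrt (Real.log r) / Real.log (Real.log r)) *
          Real.sqrt x) := by
  have hm := main_err r hr x hx
  have h0 : 0 ≤ ∏ p ∈ r.primeFactors, (1 + 1/√(p:ℝ)) := Finset.prod_nonneg fun p _ => by positivity
  constructor
  · intro h
    refine hm.trans ?_
    unfold kConst
    apply mul_le_mul_of_nonneg_right _ (Real.sqrt_nonneg x)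
    have := swap_prod r.primeFactors (fun p hp => (Nat.mem_primeFactors.1 hp).1) (omega_le r hr h)
    linarith
  · intro h
    refine hm.trans ?_
    unfold kConst
    apply mul_le_mul_of_nonneg_right _ (Real.sqrt_nonneg x)
    have := big_prod r (by omega)
    rw [mul_assoc 3.5]
    linarith
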